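/- arXiv:1908.05845 — 5 statements merged into one kernel-verified Lean document; each statement's English description precedes it below -/
import Mathlib

section
/- Let K, m : ℕ and let B : Fin (m+1) → Fin K → Fin 64 → Bool be an execution of bitmap operations on a bitmap level consisting of K containers of 64 bits each, i.e., for every step i < m there is exactly one pair (k, j) such that B i k j ≠ B (i+1) k j. For each container k, let SF k be the number of steps i < m at which container k is empty before the step and non-empty after it (set-first steps), and CL k the number of steps at which container k is non-empty before the step and empty after it (clear-last steps). Suppose the higher-level bitmap h : Fin K → Bool is initially consistent, i.e., h k = true ↔ (∃ j, B 0 k j = true). Then for every container k the generated higher-level operations are legal and restore consistency: (SF k : ℤ) − CL k ∈ {−1, 0, 1}, (if h k then 1 else 0) + SF k − CL k ∈ {0, 1}, and (if h k then 1 else 0) + SF k − CL k = 1 if and only if ∃ j, B m k j = true. -/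
/-- The indicator of a predicate telescopes along a finite sequence of states: its total change is
the number of upward transitions minus the number of downward transitions. -/
theorem card_rise_sub_card_fall (m : ℕ) (P : Fin (m + 1) → Prop) [DecidablePred P] :
    ((Finset.univ.filter fun i : Fin m => ¬ P i.castSucc ∧ P i.succ).card : ℤ) -
      (Finset.univ.filter fun i : Fin m => P i.castSucc ∧ ¬ P i.succ).card =
      (if P (Fin.last m) then 1 else 0) - (if P 0 then 1 else 0) := by
  have telescope : ∀ (n : ℕ) (f : Fin (n + 1) → ℤ),
      ∑ i : Fin n, (f i.succ - f i.castSucc) = f (Fin.last n) - f 0 := by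
    intro n f
    rw [Finset.sum_sub_distrib]
    linarith [Fin.sum_univ_succ f, Fin.sum_univ_castSucc f]
  rw [← telescope m fun i => if P i then 1 else 0, Finset.card_filter, Finset.card_filter]
  push_cast
  rw [← Finset.sum_sub_distrib]
  refine Finset.sum_congr rfl fun i _ => ?_
  by_cases h₀ : P i.castSucc <;> by_cases h₁ : P i.succ <;> simp [h₀, h₁]

/-- DynaSOAr hierarchical bitmaps: given an execution of bitmap operations on a
level of `K` containers of 64 bits (each step flips exactly one bit), and a
higher-level bitmap `h` that is initially consistent, the generated higher-level
operations for each container are legal and restore consistency. -/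
theorem higher_level_bitmap_operations_legal_and_consistent
    (K m : ℕ) (B : Fin (m + 1) → Fin K → Fin 64 → Bool)
    (hstep : ∀ i : Fin m, ∃! kj : Fin K × Fin 64,
      B i.castSucc kj.1 kj.2 ≠ B i.succ kj.1 kj.2)
    (h : Fin K → Bool)
    (hcons : ∀ k, h k = true ↔ ∃ j, B 0 k j = true) :
    ∀ k : Fin K,
      ∀ SF CL : ℕ,
        SF = (Finset.univ.filter (fun i : Fin m =>
          (¬ ∃ j, B i.castSucc k j = true) ∧ (∃ j, B i.succ k j = true))).card →
        CL = (Finset.univ.filter (fun i : Fin m =>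
          (∃ j, B i.castSucc k j = true) ∧ ¬ (∃ j, B i.succ k j = true))).card →
        ((SF : ℤ) - CL ∈ ({-1, 0, 1} : Set ℤ)) ∧
        ((if h k then (1 : ℤ) else 0) + SF - CL ∈ ({0, 1} : Set ℤ)) ∧
        (((if h k then (1 : ℤ) else 0) + SF - CL = 1) ↔
          ∃ j, B (Fin.last m) k j = true) := by
  intro k SF CL hSF hCL
  have change := card_rise_sub_card_fall m fun i => ∃ j, B i k j = true
  rw [← hSF, ← hCL] at change
  simp only [← hcons k] at change
  by_cases h₀ : h k = true <;> by_cases h₁ : ∃ j, B (Fin.last m) k j = true <;>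
    simp only [h₀, h₁, if_true, if_false, Set.mem_insert_iff, Set.mem_singleton_iff,
      iff_true, iff_false] at change ⊢ <;>
    omega
end

section
/- Let b₀ : Bool be the initial state of a bit, and let a, c : ℕ be the numbers of set and clear operations of a legal operation multiset on this bit, i.e., (a : ℤ) − c ∈ {−1, 0, 1} and (if b₀ then 1 else 0) + a − c ∈ {0, 1}. Then all operations can be executed sequentially: there exists a sequence b : Fin (a + c + 1) → Bool with b 0 = b₀ such that consecutive states differ (each step flips the bit), exactly a steps flip the bit from false to true, and exactly c steps flip the bit from true to false. (Hence for a legal multiset of bitmap operations there is always an operation that can make progress.) -/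
theorem Fin.card_filter_xor_bodd_eq_false (s : Bool) (n : ℕ) :
    (Finset.univ.filter (fun i : Fin n => (s ^^ (i : ℕ).bodd) = false)).card =
      if s then n / 2 else (n + 1) / 2 := by
  induction n with
  | zero => simp
  | succ n ih =>
    rw [Finset.card_filter] at ih ⊢
    rw [Fin.sum_univ_castSucc]
    simp only [Fin.val_castSucc, Fin.val_last, ih]
    have h := Nat.mod_two_of_bodd n
    rcases Bool.eq_false_or_eq_true n.bodd with hn | hn <;> cases s <;> simp [hn] at h ⊢ <;> omega

/-- A legal multiset of bit operations (with `a` set and `c` clear operations on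
a bit with initial value `b₀`) can be executed sequentially: there is a sequence
of bit states starting at `b₀` in which every step flips the bit, exactly `a`
steps flip it from `false` to `true` and exactly `c` steps flip it from `true`
to `false`. -/
theorem legal_bit_operations_executable
    (b₀ : Bool) (a c : ℕ)
    (h1 : (a : ℤ) - c ∈ ({-1, 0, 1} : Set ℤ))
    (h2 : (if b₀ then (1 : ℤ) else 0) + a - c ∈ ({0, 1} : Set ℤ)) :
    ∃ b : Fin (a + c + 1) → Bool,
      b 0 = b₀ ∧
      (∀ i : Fin (a + c), b i.castSucc ≠ b i.succ) ∧
      (Finset.univ.filter (fun i : Fin (a + c) =>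
        b i.castSucc = false ∧ b i.succ = true)).card = a ∧
      (Finset.univ.filter (fun i : Fin (a + c) =>
        b i.castSucc = true ∧ b i.succ = false)).card = c := by
  have h_step (s : Bool) : (Finset.univ.filter (fun i : Fin (a + c) =>
      (b₀ ^^ (i : ℕ).bodd) = s ∧ (b₀ ^^ ((i : ℕ) + 1).bodd) = !s)).card =
      if (b₀ ^^ s) then (a + c) / 2 else (a + c + 1) / 2 := by
    rw [← Fin.card_filter_xor_bodd_eq_false]
    congr 1
    ext i
    cases b₀ <;> cases s <;> simp [Nat.bodd_succ]
  refine ⟨fun i => b₀ ^^ (i : ℕ).bodd, by simp, fun i => by simp [Nat.bodd_succ], ?_, ?_⟩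
  · refine (h_step false).trans ?_
    cases b₀ <;> simp at h2 ⊢ <;> omega
  · refine (h_step true).trans ?_
    cases b₀ <;> simp at h2 ⊢ <;> omega
end

section
/- Let n and N be positive natural numbers (the defragmentation factor and the common block capacity), and let f : Fin (n+1) → ℕ be the fill levels of n+1 blocks of the same type such that every block is at most n/(n+1) full, i.e., (n+1) * f i ≤ n * N for all i. Then f 0 ≤ ∑_{i=1}^{n} (N − f i): all objects of the source block (block 0) fit into the free object slots of the n target blocks (blocks 1, …, n). -/
/-- A block that is at most `n/(n+1)` full has at least `N/(n+1)` free slots. -/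
lemma le_succ_mul_sub_of_succ_mul_le {n N k : ℕ} (h : (n + 1) * k ≤ n * N) :
    N ≤ (n + 1) * (N - k) := by
  rw [Nat.mul_sub, Nat.succ_mul n N]
  omega

/-- CompactGpu block merging: given `n + 1` blocks of common capacity `N` that
are each at most `n/(n+1)` full, all objects of the source block (block `0`)
fit into the free object slots of the `n` target blocks (blocks `1, …, n`). -/
theorem source_block_fits_into_target_blocks
    (n N : ℕ) (hn : 0 < n) (hN : 0 < N)
    (f : Fin (n + 1) → ℕ)
    (hf : ∀ i, (n + 1) * f i ≤ n * N) :
    f 0 ≤ ∑ i ∈ Finset.univ.erase (0 : Fin (n + 1)), (N - f i) := by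
  refine Nat.le_of_mul_le_mul_left ?_ n.succ_pos
  calc (n + 1) * f 0 ≤ n * N := hf 0
    _ = ∑ _i ∈ Finset.univ.erase (0 : Fin (n + 1)), N := by simp
    _ ≤ ∑ i ∈ Finset.univ.erase (0 : Fin (n + 1)), (n + 1) * (N - f i) :=
      Finset.sum_le_sum fun i _ => le_succ_mul_sub_of_succ_mul_le (hf i)
    _ = (n + 1) * ∑ i ∈ Finset.univ.erase (0 : Fin (n + 1)), (N - f i) :=
      (Finset.mul_sum _ _ _).symm
end

section
/- Let n ≥ 1 be a natural number (the defragmentation factor) and let a nonempty finite family of k allocated blocks be given, where block b has capacity N b > 0 and u b ≤ N b used object slots. If every block is more than n/(n+1) full, i.e., (n+1) * u b > n * N b for every b, then the fragmentation F = (1/k) * ∑_b ((N b − u b : ℝ) / N b) satisfies F < 1/(n+1). (Hence, if after defragmentation with factor n all defragmentation candidates have been eliminated, fragmentation is below 1/(n+1).) -/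
/-- If, after defragmentation with factor `n`, every allocated block is more
than `n/(n+1)` full, then the fragmentation (the average free level) is below
`1/(n+1)`. -/
theorem fragmentation_below_bound_after_defrag
    {ι : Type*} (n : ℕ) (hn : 1 ≤ n) (s : Finset ι) (hs : s.Nonempty)
    (N u : ι → ℕ)
    (hN : ∀ b ∈ s, 0 < N b)
    (hu : ∀ b ∈ s, u b ≤ N b)
    (hfull : ∀ b ∈ s, (n + 1) * u b > n * N b) :
    (1 / (s.card : ℝ)) * ∑ b ∈ s, (((N b : ℝ) - (u b : ℝ)) / (N b : ℝ)) <
      1 / ((n : ℝ) + 1) := by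
  have hcard : (0 : ℝ) < s.card := by exact_mod_cast hs.card_pos
  have hsum : ∑ b ∈ s, (((N b : ℝ) - (u b : ℝ)) / (N b : ℝ)) <
      ∑ _b ∈ s, 1 / ((n : ℝ) + 1) := by
    refine Finset.sum_lt_sum_of_nonempty hs fun b hb => ?_
    have hNb : (0 : ℝ) < N b := by exact_mod_cast hN b hb
    have hb' : (n : ℝ) * N b < ((n : ℝ) + 1) * u b := by exact_mod_cast hfull b hb
    rw [div_lt_div_iff₀ hNb (by positivity)]
    linarith
  rw [Finset.sum_const, nsmul_eq_mul] at hsum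
  rwa [one_div_mul_eq_div, div_lt_iff₀' hcard]
end

section
/- Let b and i be natural numbers such that the set of set-bit positions of b, {j : ℕ | Nat.testBit b j = true}, has at least i + 1 elements, and let f be the result of applying the map x ↦ x AND (x − 1), which clears the least significant set bit, i times to b. Then the set of set-bit positions of f equals the set of set-bit positions of b with its i smallest elements removed; in particular, the least element of the set of set-bit positions of f is the (i+1)-th smallest set-bit position of b. This establishes the correctness of the nth_set_bit algorithm. -/
theorem Nat.testBit_land_sub_one (x j : ℕ) :
    Nat.testBit (x &&& (x - 1)) j = true ↔
      Nat.testBit x j = true ∧ ∃ k < j, Nat.testBit x k = true := by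
  induction x using Nat.strong_induction_on generalizing j with
  | _ x ih =>
  rcases Nat.eq_zero_or_pos x with rfl | hx
  · simp
  cases j with
  | zero =>
    rw [Nat.testBit_and]
    simp only [Nat.testBit_zero, Bool.and_eq_true, decide_eq_true_eq]
    constructor
    · omega
    · simp
  | succ j =>
    rw [Nat.testBit_succ, Nat.testBit_succ, Nat.and_div_two]
    rcases Nat.mod_two_eq_zero_or_one x with h | h
    · have hdiv : (x - 1) / 2 = x / 2 - 1 := by omega
      rw [hdiv, ih (x / 2) (by omega)]
      refine and_congr_right fun _ => ⟨?_, ?_⟩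
      · rintro ⟨k, hk, hxk⟩
        exact ⟨k + 1, by omega, by rwa [Nat.testBit_succ]⟩
      · rintro ⟨k, hk, hxk⟩
        cases k with
        | zero => simp [h] at hxk
        | succ k => exact ⟨k, by omega, by rwa [Nat.testBit_succ] at hxk⟩
    · have hdiv : (x - 1) / 2 = x / 2 := by omega
      rw [hdiv, Nat.and_self]
      exact ⟨fun hj => ⟨hj, 0, by omega, by simp [h]⟩, And.left⟩

theorem Nat.testBit_iterate_land_sub_one (b i j : ℕ) :
    Nat.testBit ((fun x => x &&& (x - 1))^[i] b) j = true ↔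
      Nat.testBit b j = true ∧ i ≤ Nat.count (fun k => Nat.testBit b k = true) j := by
  induction i generalizing j with
  | zero => simp
  | succ i ih =>
    rw [Function.iterate_succ_apply', Nat.testBit_land_sub_one]
    simp only [ih]
    constructor
    · rintro ⟨⟨hj, -⟩, k, hkj, hk, hik⟩
      exact ⟨hj, hik.trans_lt (Nat.count_strict_mono hk hkj)⟩
    · rintro ⟨hj, hij⟩
      have hcard : ∀ hf : (Set.ofPred fun k => Nat.testBit b k = true).Finite,
          i < hf.toFinset.card := fun hf =>
        (Nat.lt_of_succ_le hij).trans (Nat.count_lt_card hf hj)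
      exact ⟨⟨hj, (Nat.le_succ i).trans hij⟩, _, Nat.nth_lt_of_lt_count hij,
        Nat.nth_mem i hcard, (Nat.count_nth hcard).ge⟩

theorem Nat.le_count_iff_forall_nth_lt {p : ℕ → Prop} [DecidablePred p] {i j : ℕ} (hj : p j) :
    i ≤ Nat.count p j ↔ ∀ k < i, Nat.nth p k < j := by
  refine ⟨fun h k hk => Nat.nth_lt_of_lt_count (hk.trans_le h), fun h => ?_⟩
  by_contra! hlt
  exact (h _ hlt).ne (Nat.nth_count hj)



/-- Correctness of DynaSOAr's `nth_set_bit` algorithm: if `b` has at least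
`i + 1` set bits and `f` is the result of `i` applications of
`x ↦ x AND (x − 1)` (clearing the least significant set bit) to `b`, then the
set-bit positions of `f` are exactly the set-bit positions of `b` with the `i`
smallest removed; in particular the least set-bit position of `f` is the
`(i+1)`-th smallest set-bit position of `b`. -/
theorem nth_set_bit_correct
    (b i : ℕ)
    (hcard : i + 1 ≤ {j : ℕ | Nat.testBit b j = true}.ncard)
    (f : ℕ) (hf : f = (fun x => x &&& (x - 1))^[i] b) :
    ({j : ℕ | Nat.testBit f j = true} =
      {j : ℕ | Nat.testBit b j = true} \
        (Nat.nth (fun j => Nat.testBit b j = true) '' Set.Iio i)) ∧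
    sInf {j : ℕ | Nat.testBit f j = true} =
      Nat.nth (fun j => Nat.testBit b j = true) i := by
  subst hf
  constructor
  · ext j
    simp only [Set.mem_ofPred_eq, Set.mem_sdiff, Set.mem_image, Set.mem_Iio,
      Nat.testBit_iterate_land_sub_one]
    refine and_congr_right fun hj => ⟨?_, fun h => ?_⟩
    · rintro h ⟨k, hk, hkj⟩
      exact ((Nat.le_count_iff_forall_nth_lt hj).1 h k hk).ne hkj
    · by_contra! hlt
      exact h ⟨_, hlt, Nat.nth_count hj⟩
  · rw [Nat.nth_eq_sInf]
    congr 1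
    ext j
    simp only [Set.mem_ofPred_eq, Nat.testBit_iterate_land_sub_one]
    exact and_congr_right fun hj => Nat.le_count_iff_forall_nth_lt hj
end
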